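/- Let 2 ≤ k ≤ n and for each J ∈ T^1_{k−1} let D^J ∈ Λ^k satisfy e^1⌟D^J = 0. Assume that Σ_{J∈T^1_{k−1}} ⟨D^J; a∧b⟩⟨a∧b; e^1∧e^J⟩ = 0 for all a ∈ Λ^1 and b ∈ Λ^{k−1}. If either k is odd or 2k > n, then D^J = 0 for all J ∈ T^1_{k−1}; in particular Σ_{J∈T^1_{k−1}} ⟨D^J; ω⟩⟨ω; e^1∧e^J⟩ = 0 for all ω ∈ Λ^k. -/

import Mathlib

/-! Basic setup: `Λᵏ(ℝⁿ)` in coordinates with respect to the standard basis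
`e^I`, `I` a strictly increasing multi-index (modeled as a `k`-element subset of
`Fin n`), together with the exterior product, interior product, inner product,
Hodge star, and the various notions of one-directional convexity/affinity. -/

/-- Increasing multi-indices of length `k` in `{1,…,n}`: `k`-element subsets of `Fin n`.
`Idx n k` plays the role of `T_k`. -/
abbrev Idx (n k : ℕ) := {s : Finset (Fin n) // s.card = k}

/-- `Λᵏ(ℝⁿ)`, identified with its coordinates in the standard basis `e^I`. -/
abbrev Lam (n k : ℕ) := Idx n k → ℝ

/-- The sign `sgn(R,S)` defined by `e^{[R,S]} = sgn(R,S) e^R ∧ e^S` for disjoint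
increasing multi-indices: `(-1)` to the number of inversions between `R` and `S`. -/
def msign {n : ℕ} (R S : Finset (Fin n)) : ℝ :=
  (-1 : ℝ) ^ (((R ×ˢ S).filter (fun p => p.2 < p.1)).card)

/-- The basis form `e^S` (of degree `k = S.card`; zero if `k ≠ S.card`). -/
def bform {n k : ℕ} (S : Finset (Fin n)) : Lam n k :=
  fun I => if I.1 = S then 1 else 0

/-- Exterior (wedge) product in coordinates.  When `m = k + l` this is the wedge
product `Λᵏ × Λˡ → Λ^{k+l}`; for other `m` it is `0`. -/
def wedge {n k l m : ℕ} (ω : Lam n k) (φ : Lam n l) : Lam n m :=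
  fun I => ∑ R : Idx n k, ∑ S : Idx n l,
    if R.1 ∪ S.1 = I.1 ∧ Disjoint R.1 S.1 then msign R.1 S.1 * (ω R * φ S) else 0

/-- Interior product `a ⌟ b`, characterized by `⟨a ⌟ b; c⟩ = ⟨b; a ∧ c⟩`.  When
`m = k - j` this is the interior product `Λʲ × Λᵏ → Λ^{k-j}`; for other `m` it is `0`. -/
def iprod {n j k m : ℕ} (a : Lam n j) (b : Lam n k) : Lam n m :=
  fun C => ∑ A : Idx n j, ∑ B : Idx n k,
    if A.1 ∪ C.1 = B.1 ∧ Disjoint A.1 C.1 then msign A.1 C.1 * (a A * b B) else 0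

/-- Hodge star with respect to the standard orientation; when `m = n - k` this is
`∗ : Λᵏ → Λ^{n-k}`. -/
def hstar {n k m : ℕ} (ω : Lam n k) : Lam n m :=
  fun J => ∑ I : Idx n k, if I.1 = (J.1)ᶜ then msign I.1 J.1 * ω I else 0

/-- Inner product `⟨·;·⟩` on `Λᵏ` (the basis `e^I` is orthonormal). -/
def ip {n k : ℕ} (ω α : Lam n k) : ℝ := ∑ I : Idx n k, ω I * α I

/-- `s`-fold exterior power `ω^s = ω ∧ ⋯ ∧ ω` (with `ω^0 = 1 ∈ Λ⁰`). -/
def lpow {n k : ℕ} (ω : Lam n k) : (s : ℕ) → Lam n (k * s)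
  | 0 => bform ∅
  | s + 1 => wedge ω (lpow ω s)

/-- `f : Λᵏ → ℝ` is ext. one convex. -/
def ExtOneConvex {n k : ℕ} (f : Lam n k → ℝ) : Prop :=
  ∀ (ω : Lam n k) (a : Lam n 1) (b : Lam n (k-1)),
    ConvexOn ℝ Set.univ (fun t : ℝ => f (ω + t • (wedge a b : Lam n k)))

/-- `f : Λᵏ → ℝ` is ext. one affine. -/
def ExtOneAffine {n k : ℕ} (f : Lam n k → ℝ) : Prop :=
  ExtOneConvex f ∧ ExtOneConvex (fun ω => -f ω)

/-- `f : Λᵏ → ℝ` is int. one convex. -/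
def IntOneConvex {n k : ℕ} (f : Lam n k → ℝ) : Prop :=
  ∀ (ω : Lam n k) (a : Lam n 1) (b : Lam n (k+1)),
    ConvexOn ℝ Set.univ (fun t : ℝ => f (ω + t • (iprod a b : Lam n k)))

/-- `f : Λᵏ → ℝ` is int. one affine. -/
def IntOneAffine {n k : ℕ} (f : Lam n k → ℝ) : Prop :=
  IntOneConvex f ∧ IntOneConvex (fun ω => -f ω)

/-- `f : Λ^{k+1} × Λ^{k-1} → ℝ` is ext-int. one convex. -/
def ExtIntOneConvex {n k : ℕ} (f : Lam n (k+1) → Lam n (k-1) → ℝ) : Prop :=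
  ∀ (ξ : Lam n (k+1)) (η : Lam n (k-1)) (a : Lam n 1) (b : Lam n k),
    ConvexOn ℝ Set.univ
      (fun t : ℝ => f (ξ + t • (wedge a b : Lam n (k+1))) (η + t • (iprod a b : Lam n (k-1))))

/-- `f : Λ^{k+1} × Λ^{k-1} → ℝ` is ext-int. one affine. -/
def ExtIntOneAffine {n k : ℕ} (f : Lam n (k+1) → Lam n (k-1) → ℝ) : Prop :=
  ExtIntOneConvex f ∧ ExtIntOneConvex (fun ξ η => -f ξ η)

/-- `g : Λᵏ → ℝ` is affine, i.e. a constant plus a linear functional. -/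
def AffineFn {n k : ℕ} (g : Lam n k → ℝ) : Prop :=
  ∃ (c : ℝ) (a : Lam n k), ∀ ω, g ω = c + ip a ω


section Auxiliary

open Finset

section Signs

variable {n : ℕ}

theorem msign_eq_prod (A B : Finset (Fin n)) :
    msign A B = ∏ a ∈ A, ∏ b ∈ B, if b < a then (-1 : ℝ) else 1 := by
  rw [msign, ← prod_product' A B (fun a b => if b < a then (-1 : ℝ) else 1), prod_ite]
  simp

theorem msign_insert_left {j : Fin n} {A : Finset (Fin n)} (B : Finset (Fin n)) (hj : j ∉ A) :
    msign (insert j A) B = msign {j} B * msign A B := by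
  simp [msign_eq_prod, prod_insert hj]

theorem msign_insert_right {j : Fin n} (A : Finset (Fin n)) {B : Finset (Fin n)} (hj : j ∉ B) :
    msign A (insert j B) = msign A {j} * msign A B := by
  simp only [msign_eq_prod, prod_insert hj, prod_mul_distrib, prod_singleton]

theorem msign_mul_swap {A B : Finset (Fin n)} (h : Disjoint A B) :
    msign A B * msign B A = (-1) ^ (#A * #B) := by
  rw [msign_eq_prod, msign_eq_prod, prod_comm (s := B), ← prod_mul_distrib]
  have : ∀ a ∈ A, (∏ b ∈ B, if b < a then (-1 : ℝ) else 1) *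
      (∏ b ∈ B, if a < b then (-1 : ℝ) else 1) = (-1) ^ #B := by
    intro a ha
    rw [← prod_mul_distrib, ← prod_const]
    refine prod_congr rfl fun b hb => ?_
    rcases lt_trichotomy a b with hab | hab | hab
    · simp [hab, hab.le]
    · exact absurd hb (hab ▸ disjoint_left.1 h ha)
    · simp [hab, hab.le]
  rw [prod_congr rfl this, prod_const, ← pow_mul, mul_comm]

theorem msign_mul_self (A B : Finset (Fin n)) : msign A B * msign A B = 1 := by
  rw [msign, ← mul_pow]
  simp

theorem msign_ne_zero (A B : Finset (Fin n)) : msign A B ≠ 0 :=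
  left_ne_zero_of_mul_eq_one (msign_mul_self A B)

theorem msign_swap {A B : Finset (Fin n)} (h : Disjoint A B) :
    msign B A = (-1) ^ (#A * #B) * msign A B := by
  rw [← msign_mul_swap h]
  linear_combination -msign B A * msign_mul_self A B

theorem msign_singleton_of_min {e : Fin n} (he : (e : ℕ) = 0) (B : Finset (Fin n)) :
    msign {e} B = 1 := by
  have : ∀ b : Fin n, ¬ b < e := fun b hb => by
    have := Fin.lt_def.1 hb
    omega
  simp [msign_eq_prod, this]

end Signs

section Bilinear

variable {n k l m : ℕ}

theorem ip_add_left (x y z : Lam n k) : ip (x + y) z = ip x z + ip y z := by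
  simp [ip, add_mul, sum_add_distrib]

theorem ip_add_right (x y z : Lam n k) : ip x (y + z) = ip x y + ip x z := by
  simp [ip, mul_add, sum_add_distrib]

theorem ip_smul_left (c : ℝ) (x y : Lam n k) : ip (c • x) y = c * ip x y := by
  simp [ip, mul_sum, mul_assoc]

theorem ip_smul_right (c : ℝ) (x y : Lam n k) : ip x (c • y) = c * ip x y := by
  simp [ip, mul_sum, mul_left_comm]

theorem ip_bform_right (x : Lam n k) {I : Finset (Fin n)} (hI : #I = k) :
    ip x (bform I) = x ⟨I, hI⟩ := by
  rw [ip, Fintype.sum_eq_single ⟨I, hI⟩]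
  · simp [bform]
  · intro J hJ
    have : J.1 ≠ I := fun h => hJ (Subtype.ext h)
    simp [bform, this]

theorem wedge_add_left (x y : Lam n k) (z : Lam n l) :
    (wedge (x + y) z : Lam n m) = wedge x z + wedge y z := by
  funext I
  simp only [wedge, Pi.add_apply, ← sum_add_distrib]
  refine sum_congr rfl fun R _ => sum_congr rfl fun S _ => ?_
  split_ifs <;> ring

theorem wedge_add_right (x : Lam n k) (y z : Lam n l) :
    (wedge x (y + z) : Lam n m) = wedge x y + wedge x z := by
  funext I
  simp only [wedge, Pi.add_apply, ← sum_add_distrib]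
  refine sum_congr rfl fun R _ => sum_congr rfl fun S _ => ?_
  split_ifs <;> ring

theorem wedge_bform_apply {A K : Finset (Fin n)} (hA : #A = k) (hK : #K = l) (I : Idx n m) :
    (wedge (bform A : Lam n k) (bform K : Lam n l) : Lam n m) I =
      if A ∪ K = I.1 ∧ Disjoint A K then msign A K else 0 := by
  rw [wedge, Fintype.sum_eq_single ⟨A, hA⟩, Fintype.sum_eq_single ⟨K, hK⟩]
  · simp [bform]
  · intro S hS
    have : S.1 ≠ K := fun h => hS (Subtype.ext h)
    simp [bform, this]
  · intro R hR
    have : R.1 ≠ A := fun h => hR (Subtype.ext h)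
    simp [bform, this]

theorem wedge_bform_singleton {i : Fin n} {K : Finset (Fin n)} (hK : #K = l) (hi : i ∉ K) :
    (wedge (bform {i} : Lam n 1) (bform K : Lam n l) : Lam n m) =
      msign {i} K • bform (insert i K) := by
  funext I
  rw [wedge_bform_apply (card_singleton i) hK]
  simp [bform, hi, eq_comm]

theorem iprod_bform_apply {A : Finset (Fin n)} (hA : #A = l) (x : Lam n k) (C : Idx n m)
    (hAC : Disjoint A C.1) (hk : #(A ∪ C.1) = k) :
    (iprod (bform A : Lam n l) x : Lam n m) C = msign A C.1 * x ⟨A ∪ C.1, hk⟩ := by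
  rw [iprod, Fintype.sum_eq_single ⟨A, hA⟩, Fintype.sum_eq_single ⟨A ∪ C.1, hk⟩]
  · simp [bform, hAC]
  · intro S hS
    have : A ∪ C.1 ≠ S.1 := fun h => hS (Subtype.ext h.symm)
    simp [this]
  · intro R hR
    have : R.1 ≠ A := fun h => hR (Subtype.ext h)
    simp [bform, this]

/-- A bi-additive form whose diagonal vanishes on all products `a ∧ b` has vanishing
polarization in both factors. -/
theorem polarization_wedge_eq_zero (F : Lam n m → Lam n m → ℝ)
    (hl : ∀ x y z, F (x + y) z = F x z + F y z) (hr : ∀ x y z, F x (y + z) = F x y + F x z)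
    (h : ∀ (a : Lam n k) (b : Lam n l), F (wedge a b) (wedge a b) = 0)
    (a a' : Lam n k) (b b' : Lam n l) :
    F (wedge a b) (wedge a' b') + F (wedge a' b') (wedge a b) +
      (F (wedge a b') (wedge a' b) + F (wedge a' b) (wedge a b')) = 0 := by
  have h1 := h (a + a') (b + b')
  have h2 := h (a + a') b
  have h3 := h (a + a') b'
  have h4 := h a (b + b')
  have h5 := h a' (b + b')
  simp only [wedge_add_left, wedge_add_right, hl, hr] at h1 h2 h3 h4 h5
  linarith [h a b, h a b', h a' b, h a' b']

end Bilinear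

section Exchange

variable {α : Type*} [DecidableEq α]

/-- A function of `m`-subsets of `U` invariant under exchanging one element is constant. -/
theorem eq_of_exchange {β : Type*} {U : Finset α} {m : ℕ} (h : Finset α → β)
    (hex : ∀ (J : Finset α) (i j : α), #J + 1 = m → J ⊆ U → i ∈ U → j ∈ U → i ∉ J → j ∉ J →
      i ≠ j → h (insert j J) = h (insert i J))
    {J K : Finset α} (hJ : #J = m) (hK : #K = m) (hJU : J ⊆ U) (hKU : K ⊆ U) : h J = h K := by
  induction hN : #(J \ K) generalizing J with
  | zero =>
    rw [eq_of_subset_of_card_le (sdiff_eq_empty_iff_subset.1 (card_eq_zero.1 hN)) (by omega)]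
  | succ N ih =>
    obtain ⟨j, hj⟩ : (J \ K).Nonempty := card_pos.1 (by omega)
    have hcard : #(K \ J) = #(J \ K) := card_sdiff_comm (by omega)
    obtain ⟨i, hi⟩ : (K \ J).Nonempty := card_pos.1 (by omega)
    rw [mem_sdiff] at hi hj
    have hcj := card_erase_add_one hj.1
    have hij : i ∉ J.erase j := fun h => hi.2 (mem_of_mem_erase h)
    have h1 := hex (J.erase j) i j (by omega) ((erase_subset _ _).trans hJU) (hKU hi.1)
      (hJU hj.1) hij (notMem_erase _ _) (fun h => hi.2 (h ▸ hj.1))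
    rw [insert_erase hj.1] at h1
    rw [h1]
    apply ih
    · rw [card_insert_of_notMem hij]
      omega
    · exact insert_subset (hKU hi.1) ((erase_subset _ _).trans hJU)
    · rw [insert_sdiff_of_mem _ hi.1, erase_sdiff_comm, card_erase_of_mem (mem_sdiff.2 hj)]
      omega

end Exchange

section Coefficients

variable {n m : ℕ}

/-- For even `m`, a matrix indexed by disjoint pairs of an `m`-set and an `(m+1)`-set which
satisfies the linear relations imposed by vanishing on products is zero. -/
theorem eq_zero_of_alternating {U : Finset (Fin n)} (d : Finset (Fin n) → Finset (Fin n) → ℝ)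
    (hm : Even m)
    (hexch : ∀ (i j : Fin n) (J I : Finset (Fin n)), #J + 1 = m → #I = m →
      J ⊆ U → I ⊆ U → i ∈ U → j ∈ U → i ≠ j → i ∉ J → j ∉ J → i ∉ I → j ∉ I → Disjoint J I →
      msign {j} J * msign {i} I * d (insert j J) (insert i I) +
        msign {i} J * msign {j} I * d (insert i J) (insert j I) = 0)
    (hswap : ∀ (i : Fin n) (J K : Finset (Fin n)), #J = m → #K = m → J ⊆ U → K ⊆ U → i ∈ U →
      i ∉ J → i ∉ K → Disjoint J K →
      msign {i} K * d J (insert i K) + msign {i} J * d K (insert i J) = 0)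
    {J I : Finset (Fin n)} (hJ : #J = m) (hI : #I = m + 1) (hJU : J ⊆ U) (hIU : I ⊆ U)
    (hd : Disjoint J I) : d J I = 0 := by
  obtain ⟨i, hi⟩ : I.Nonempty := card_pos.1 (by omega)
  obtain ⟨K, hiK, rfl⟩ : ∃ K, i ∉ K ∧ insert i K = I :=
    ⟨I.erase i, notMem_erase _ _, insert_erase hi⟩
  rw [card_insert_of_notMem hiK] at hI
  rw [insert_subset_iff] at hIU
  rw [disjoint_insert_right] at hd
  obtain ⟨hiJ, hJK⟩ := hd
  set V := J ∪ insert i K with hV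
  have hVcard : #V = 2 * m + 1 := by
    rw [hV, card_union_of_disjoint (disjoint_insert_right.2 ⟨hiJ, hJK⟩),
      card_insert_of_notMem hiK]
    omega
  have hVU : V ⊆ U := union_subset hJU (insert_subset hIU.1 hIU.2)
  have key : msign J (V \ J) * d J (V \ J) = msign K (V \ K) * d K (V \ K) := by
    refine eq_of_exchange (U := V) (fun L => msign L (V \ L) * d L (V \ L)) ?_ hJ (by omega)
      subset_union_left ((subset_insert _ _).trans subset_union_right)
    intro L p q hL hLV hp hq hpL hqL hpq
    set M := V \ insert p (insert q L) with hM
    have hpM : p ∉ M := by simp [hM]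
    have hqM : q ∉ M := by simp [hM]
    have hLM : Disjoint L M := by
      rw [hM]
      exact disjoint_sdiff.mono_left ((subset_insert _ _).trans (subset_insert _ _))
    have e1 : V \ insert q L = insert p M := by
      ext x; simp only [hM, mem_sdiff, mem_insert]
      by_cases hx : x = p
      · subst hx; simp [hp, hpq, hpL]
      · simp [hx]
    have e2 : V \ insert p L = insert q M := by
      ext x; simp only [hM, mem_sdiff, mem_insert]
      by_cases hx : x = q
      · subst hx; simp [hq, hpq.symm, hqL]
      · simp [hx]
    have hMcard : #M = m := by
      rw [hM, card_sdiff_of_subset (insert_subset hp (insert_subset hq hLV)),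
        card_insert_of_notMem (by simp [hpq, hpL]), card_insert_of_notMem hqL]
      omega
    have := hexch p q L M hL hMcard (hLV.trans hVU) (sdiff_subset.trans hVU) (hVU hp) (hVU hq)
      hpq hpL hqL hpM hqM hLM
    simp only [e1, e2]
    rw [msign_insert_left _ hqL, msign_insert_left _ hpL, msign_insert_right _ hpM,
      msign_insert_right _ hqM, msign_insert_right _ hpM, msign_insert_right _ hqM,
      msign_swap (A := {p}) (B := L) (by simpa using hpL),
      msign_swap (A := {q}) (B := L) (by simpa using hqL),
      msign_swap (A := {p}) (B := {q}) (by simpa using hpq)]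
    simp only [card_singleton, one_mul, pow_one]
    have hcross : msign {q} M * msign {p} L * d (insert q L) (insert p M) +
        msign {p} M * msign {q} L * d (insert p L) (insert q M) = 0 := by
      linear_combination
        (msign {p} L * msign {q} L * msign {p} M * msign {q} M) * this -
        msign {q} M * msign {p} L * d (insert q L) (insert p M) *
          (msign {p} M ^ 2 * msign_mul_self {q} L + msign_mul_self {p} M) -
        msign {p} M * msign {q} L * d (insert p L) (insert q M) *
          (msign {q} M ^ 2 * msign_mul_self {p} L + msign_mul_self {q} M)
    linear_combination (-msign {p} {q} * (-1) ^ #L * msign L M) * hcross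
  have e1 : V \ J = insert i K := by
    rw [hV, union_sdiff_cancel_left (disjoint_insert_right.2 ⟨hiJ, hJK⟩)]
  have e2 : V \ K = insert i J := by
    ext x
    have : x ∈ J → x ∉ K := fun h => disjoint_left.1 hJK h
    simp only [hV, mem_sdiff, mem_union, mem_insert]
    by_cases hx : x = i
    · subst hx; simp [hiK]
    · simp only [hx]; tauto
  rw [e1, e2, msign_insert_right _ hiK, msign_insert_right _ hiJ,
    msign_swap (A := {i}) (B := J) (by simpa using hiJ),
    msign_swap (A := {i}) (B := K) (by simpa using hiK), msign_swap hJK, hJ,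
    (by omega : #K = m)] at key
  simp only [card_singleton, one_mul, hm.neg_one_pow, (hm.mul_left m).neg_one_pow] at key
  have hs := hswap i J K hJ (by omega) hJU hIU.2 hIU.1 hiJ hiK hJK
  linear_combination (1 / 2) * (msign {i} J * msign J K * key + msign {i} K * hs) -
    (1 / 2) * d J (insert i K) *
      (msign J K ^ 2 * msign_mul_self {i} J + msign_mul_self J K + msign_mul_self {i} K) +
    (1 / 2) * msign {i} J * msign {i} K * d K (insert i J) * msign_mul_self J K

/-- If `e ⌟ x = 0` then every coefficient of `x` on a basis form containing `e` vanishes. -/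
theorem apply_eq_zero_of_iprod_eq_zero {e : Fin n} {x : Lam n (m + 1)}
    (hx : (iprod (bform {e} : Lam n 1) x : Lam n m) = 0) (I : Idx n (m + 1)) (he : e ∈ I.1) :
    x I = 0 := by
  have hI : {e} ∪ I.1.erase e = I.1 := by rw [← insert_eq, insert_erase he]
  have h := congrFun hx ⟨I.1.erase e, by rw [card_erase_of_mem he, I.2]; rfl⟩
  rw [iprod_bform_apply (card_singleton e) _ _ (by simp) (by rw [hI, I.2])] at h
  have h' := (mul_eq_zero.1 h).resolve_left (msign_ne_zero _ _)
  convert h' using 2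
  exact Subtype.ext hI.symm

theorem coefficients_eq_zero (e : Fin n) (he : (e : ℕ) = 0)
    (D : Idx n m → Lam n (m + 1))
    (hD : ∀ J : Idx n m, e ∉ J.1 → (iprod (bform {e} : Lam n 1) (D J) : Lam n m) = 0)
    (hmain : ∀ (a : Lam n 1) (b : Lam n m),
      ∑ J ∈ univ.filter (fun J : Idx n m => e ∉ J.1),
        ip (D J) (wedge a b) *
          ip (wedge a b : Lam n (m + 1)) (wedge (bform {e} : Lam n 1) (bform J.1 : Lam n m)) = 0)
    (hcase : Even m ∨ n < 2 * (m + 1)) (J : Idx n m) (hJ : e ∉ J.1) : D J = 0 := by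
  set F : Lam n (m + 1) → Lam n (m + 1) → ℝ := fun x y =>
    ∑ J ∈ univ.filter (fun J : Idx n m => e ∉ J.1),
      ip (D J) x * ip y (wedge (bform {e} : Lam n 1) (bform J.1 : Lam n m)) with hF
  have hFl : ∀ x y z, F (x + y) z = F x z + F y z := fun x y z => by
    simp [hF, ip_add_right, add_mul, sum_add_distrib]
  have hFr : ∀ x y z, F x (y + z) = F x y + F x z := fun x y z => by
    simp [hF, ip_add_left, mul_add, sum_add_distrib]
  have hFsl : ∀ (c : ℝ) x y, F (c • x) y = c * F x y := fun c x y => by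
    simp [hF, ip_smul_right, mul_sum, mul_assoc]
  have hFsr : ∀ (c : ℝ) x y, F x (c • y) = c * F x y := fun c x y => by
    simp [hF, ip_smul_left, mul_sum, mul_left_comm]
  set p : Finset (Fin n) → Finset (Fin n) → ℝ := fun I I' =>
    F (bform I) (bform I') + F (bform I') (bform I) with hp
  have hpsymm : ∀ I I', p I I' = p I' I := fun I I' => add_comm _ _
  have hFbform : ∀ (I : Finset (Fin n)) (L : Finset (Fin n)) (hI : #I = m + 1) (hL : #L = m),
      e ∉ L → F (bform I) (bform (insert e L)) = D ⟨L, hL⟩ ⟨I, hI⟩ := by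
    intro I L hI hL heL
    rw [hF]
    dsimp only
    rw [sum_eq_single ⟨L, hL⟩]
    · rw [ip_bform_right _ hI, wedge_bform_singleton hL heL, msign_singleton_of_min he, one_smul,
        ip_bform_right _ (by rw [card_insert_of_notMem heL, hL])]
      simp [bform]
    · intro K hK hKL
      have heK : e ∉ K.1 := (mem_filter.1 hK).2
      rw [wedge_bform_singleton K.2 heK, ip_smul_right,
        ip_bform_right (I := insert e K.1) _ (by rw [card_insert_of_notMem heK, K.2])]
      have : insert e K.1 ≠ insert e L := fun h => hKL <| Subtype.ext <| by
        rw [← erase_insert heK, h, erase_insert heL]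
      simp [bform, this]
    · simp [heL]
  have hFzero : ∀ (I : Finset (Fin n)) (y : Lam n (m + 1)), #I = m + 1 → e ∈ I →
      F (bform I) y = 0 := by
    intro I y hI heI
    refine sum_eq_zero fun K hK => ?_
    rw [ip_bform_right _ hI,
      apply_eq_zero_of_iprod_eq_zero (hD K (mem_filter.1 hK).2) ⟨I, hI⟩ heI, zero_mul]
  have hpD : ∀ (I L : Finset (Fin n)) (hI : #I = m + 1) (hL : #L = m), e ∉ L →
      p I (insert e L) = D ⟨L, hL⟩ ⟨I, hI⟩ := by
    intro I L hI hL heL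
    rw [hp]
    dsimp only
    rw [hFbform I L hI hL heL, hFzero (insert e L) _ (by rw [card_insert_of_notMem heL, hL])
      (mem_insert_self _ _), add_zero]
  have hpol : ∀ (i i' : Fin n) (K K' : Finset (Fin n)), #K = m → #K' = m → i ∉ K → i ∉ K' →
      i' ∉ K → i' ∉ K' →
      msign {i} K * msign {i'} K' * p (insert i K) (insert i' K') +
        msign {i} K' * msign {i'} K * p (insert i K') (insert i' K) = 0 := by
    intro i i' K K' hK hK' h1 h2 h3 h4
    have := polarization_wedge_eq_zero F hFl hFr hmain (bform {i}) (bform {i'}) (bform K)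
      (bform K')
    simp only [wedge_bform_singleton hK h1, wedge_bform_singleton hK h3,
      wedge_bform_singleton hK' h2, wedge_bform_singleton hK' h4, hFsl, hFsr] at this
    rw [hp]
    linear_combination this
  have hsign : ∀ (j : Fin n) (L : Finset (Fin n)), j ≠ e → e ∉ L →
      msign {j} (insert e L) = -msign {j} L := by
    intro j L hj hL
    rw [msign_insert_right _ hL, msign_swap (A := {e}) (B := {j}) (by simpa using hj.symm),
      msign_singleton_of_min he]
    simp
  funext I
  by_cases heI : e ∈ I.1
  · exact apply_eq_zero_of_iprod_eq_zero (hD J hJ) I heI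
  have hgoal : p I.1 (insert e J.1) = D J I := hpD I.1 J.1 I.2 J.2 hJ
  rw [Pi.zero_apply, ← hgoal]
  by_cases hdisj : Disjoint J.1 I.1
  · have hJU : J.1 ⊆ univ.erase e := fun x hx => by
      simpa using fun h : x = e => hJ (h ▸ hx)
    have hIU : I.1 ⊆ univ.erase e := fun x hx => by
      simpa using fun h : x = e => heI (h ▸ hx)
    rcases hcase with hm | hn
    · refine eq_zero_of_alternating (U := univ.erase e) (fun J I => p I (insert e J)) hm ?_ ?_
        J.2 I.2 hJU hIU hdisj
      · intro i j L M hL hM hLU hMU hiU hjU hij hiL hjL hiM hjM _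
        have heL : e ∉ L := fun h => by simpa using hLU h
        have hie : i ≠ e := by simpa using hiU
        have hje : j ≠ e := by simpa using hjU
        have h := hpol j i (insert e L) M (by rw [card_insert_of_notMem heL, hL]) hM
          (by simp [hje, hjL]) hjM (by simp [hie, hiL]) hiM
        rw [hsign j L hje heL, hsign i L hie heL, hpsymm, insert_comm j e, insert_comm i e] at h
        linear_combination -h
      · intro i L M hL hM hLU hMU hiU hiL hiM _
        have heL : e ∉ L := fun h => by simpa using hLU h
        have heM : e ∉ M := fun h => by simpa using hMU h
        have h := hpol e i L M hL hM heL heM hiL hiM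
        rw [msign_singleton_of_min he, msign_singleton_of_min he, hpsymm,
          hpsymm (insert e M)] at h
        linear_combination h
    · have h := card_le_card (union_subset hJU hIU)
      rw [card_union_of_disjoint hdisj, J.2, I.2, card_erase_of_mem (mem_univ _), card_univ,
        Fintype.card_fin] at h
      omega
  · obtain ⟨x, hxJ, hxI⟩ := not_disjoint_iff.1 hdisj
    have hxe : x ≠ e := fun h => hJ (h ▸ hxJ)
    have hJ' : insert x (insert e (J.1.erase x)) = insert e J.1 := by
      rw [insert_comm, insert_erase hxJ]
    have hI' : insert x (I.1.erase x) = I.1 := insert_erase hxI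
    have hJcard := card_erase_add_one hxJ
    have h := hpol x x (insert e (J.1.erase x)) (I.1.erase x)
      (by rw [card_insert_of_notMem (fun h => hJ (mem_of_mem_erase h)), hJcard, J.2])
      (by rw [card_erase_of_mem hxI, I.2]; rfl) (by simp [hxe]) (by simp) (by simp [hxe]) (by simp)
    rw [hJ', hI', hpsymm] at h
    refine (mul_eq_zero.1 ?_).resolve_left
      (mul_ne_zero (msign_ne_zero {x} (insert e (J.1.erase x))) (msign_ne_zero {x} (I.1.erase x)))
    linear_combination h / 2

end Coefficients

end Auxiliary

/-- **Lemma (vanishing case).** Let `2 ≤ k ≤ n` and for each `J ∈ T¹_{k-1}` let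
`D^J ∈ Λᵏ` satisfy `e^1 ⌟ D^J = 0`.  If
`∑_{J ∈ T¹_{k-1}} ⟨D^J; a∧b⟩⟨a∧b; e^1∧e^J⟩ = 0` for all `a ∈ Λ¹`, `b ∈ Λ^{k-1}`, and
either `k` is odd or `2k > n`, then `D^J = 0` for all `J ∈ T¹_{k-1}`; in particular
`∑_{J ∈ T¹_{k-1}} ⟨D^J; ω⟩⟨ω; e^1∧e^J⟩ = 0` for all `ω ∈ Λᵏ`. -/
theorem stmt13 {n k : ℕ} (hk : 2 ≤ k) (hkn : k ≤ n)
    (e1 : Fin n) (he1 : (e1 : ℕ) = 0)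
    (D : Idx n (k-1) → Lam n k)
    (hD : ∀ J : Idx n (k-1), e1 ∉ J.1 →
      (iprod (bform {e1} : Lam n 1) (D J) : Lam n (k-1)) = 0)
    (hmain : ∀ (a : Lam n 1) (b : Lam n (k-1)),
      ∑ J ∈ Finset.univ.filter (fun J : Idx n (k-1) => e1 ∉ J.1),
        ip (D J) (wedge a b) *
          ip ((wedge a b : Lam n k)) (wedge (bform {e1} : Lam n 1) (bform J.1 : Lam n (k-1))) = 0)
    (hcase : Odd k ∨ n < 2 * k) :
    (∀ J : Idx n (k-1), e1 ∉ J.1 → D J = 0) ∧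
    (∀ ω : Lam n k,
      ∑ J ∈ Finset.univ.filter (fun J : Idx n (k-1) => e1 ∉ J.1),
        ip (D J) ω *
          ip ω (wedge (bform {e1} : Lam n 1) (bform J.1 : Lam n (k-1))) = 0) := by
  have hzero : ∀ J : Idx n (k - 1), e1 ∉ J.1 → D J = 0 := by
    obtain ⟨m, rfl⟩ : ∃ m, k = m + 1 := ⟨k - 1, by omega⟩
    refine coefficients_eq_zero e1 he1 D hD hmain (hcase.imp_left fun h => ?_)
    simpa [Nat.odd_add_one] using h
  refine ⟨hzero, fun ω => Finset.sum_eq_zero fun J hJ => ?_⟩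
  rw [hzero J (Finset.mem_filter.1 hJ).2]
  simp [ip]
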